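/- Dp-rank is subadditive: if A is a set, a_1, a_2 are tuples, k_1, k_2 < ω, and tp(a_i/A) has dp-rank ≤ k_i for i = 1, 2, then tp(a_1, a_2 / A) has dp-rank ≤ k_1 + k_2. (Theorem 3.4, quoted from Kaplan–Onshuus–Usvyatsov) -/

import Mathlib

open FirstOrder FirstOrder.Language

namespace VCPaper

variable {L : Language}

/-- `a` realizes the partial type `p(x)`. -/
def RealizesType {M : Type*} [L.Structure M] {α : Type*}
    (p : Set (L.Formula α)) (a : α → M) : Prop :=
  ∀ ψ ∈ p, ψ.Realize a

/-- The family `b` (of `β`-tuples), indexed by a linear order `I`, is an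
indiscernible sequence: any two strictly increasing tuples of indices of the
same length satisfy the same formulas. -/
def IsIndiscernible (L : Language) {M : Type*} [L.Structure M] {β : Type*} {I : Type*}
    [LinearOrder I] (b : I → β → M) : Prop :=
  ∀ (n : ℕ) (ψ : L.Formula (Fin n × β)) (i j : Fin n → I), StrictMono i → StrictMono j →
    (ψ.Realize (fun v => b (i v.1) v.2) ↔ ψ.Realize (fun v => b (j v.1) v.2))

/-- `S_φ(B) ∩ [p]` for the finite sequence `b = ⟨b_i : i < N⟩`: the set of
`φ`-types over the terms of the sequence consistent with `p` (in the monster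
model, consistent = realized). -/
def SeqPhiTypes {M : Type*} [L.Structure M] {α β : Type*} (φ : L.Formula (α ⊕ β))
    (p : Set (L.Formula α)) {N : ℕ} (b : Fin N → β → M) : Set (Fin N → Bool) :=
  { q | ∃ a : α → M, RealizesType p a ∧ ∀ i, (q i = true ↔ φ.Realize (Sum.elim a (b i))) }

/-- `φ(x;y)` has VC_ind-density `≤ ℓ` with respect to `p`. -/
def VCIndDensityLE (M : Type*) [L.Structure M] {α β : Type*} (φ : L.Formula (α ⊕ β))
    (p : Set (L.Formula α)) (ℓ : ℝ) : Prop :=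
  ∃ K : ℝ, ∀ N : ℕ, 0 < N → ∀ b : Fin N → β → M, IsIndiscernible L b →
    ((SeqPhiTypes φ p b).ncard : ℝ) ≤ K * (N : ℝ) ^ ℓ

/-- `i ∼_C j` for `i, j ∈ ℚ` and `C ⊆ ℝ` (`ℝ` being the completion of `ℚ`). -/
def SimRel (C : Set ℝ) (i j : ℚ) : Prop :=
  ∀ c ∈ C, ((c ≤ (i : ℝ)) ↔ (c ≤ (j : ℝ))) ∧ (((i : ℝ) ≤ c) ↔ ((j : ℝ) ≤ c))

/-- `φ(x;y)` has local dp-rank `≤ n` with respect to `p`. -/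
def LocalDpRankLE (M : Type*) [L.Structure M] {α β : Type*} (φ : L.Formula (α ⊕ β))
    (p : Set (L.Formula α)) (n : ℕ) : Prop :=
  ∀ a : α → M, RealizesType p a → ∀ b : ℚ → β → M, IsIndiscernible L b →
    ∃ C : Finset ℝ, C.card ≤ n ∧ ∀ i j : ℚ, SimRel (↑C) i j →
      (φ.Realize (Sum.elim a (b i)) ↔ φ.Realize (Sum.elim a (b j)))

/-- The partial type `p(x)` has dp-rank `≤ n`. -/
def DpRankLE (M : Type*) [L.Structure M] {α : Type*}
    (p : Set (L.Formula α)) (n : ℕ) : Prop :=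
  ∀ a : α → M, RealizesType p a → ∀ (γ : Type) (b : ℚ → γ → M), IsIndiscernible L b →
    ∃ C : Finset ℝ, C.card ≤ n ∧ ∀ i j : ℚ, SimRel (↑C) i j →
      ∀ ψ : L.Formula (γ ⊕ α),
        (ψ.Realize (Sum.elim (b i) a) ↔ ψ.Realize (Sum.elim (b j) a))

/-- `φ(x;y)` has UDTFS_ind-rank `≤ n` with respect to `p`. -/
def UDTFSIndRankLE (M : Type*) [L.Structure M] {α β : Type*} (φ : L.Formula (α ⊕ β))
    (p : Set (L.Formula α)) (n : ℕ) : Prop :=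
  ∃ (ℓ k R : ℕ)
    (ψ : Fin R → L.Formula (β ⊕ ((Fin n × Fin (ℓ + 1)) ⊕ Fin k) × β)),
    ∀ N : ℕ, 0 < N → ∀ b : Fin N → β → M, IsIndiscernible L b →
      ∃ jj : Fin k → Fin N, ∀ q ∈ SeqPhiTypes φ p b,
        ∃ (r : Fin R) (ii : Fin n → ℕ) (g : (Fin n × Fin (ℓ + 1)) ⊕ Fin k → Fin N),
          (∀ m, ii m < N) ∧
          (∀ (m : Fin n) (t : Fin (ℓ + 1)), ii m + (t : ℕ) < N →
            ((g (Sum.inl (m, t)) : ℕ) = ii m + (t : ℕ))) ∧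
          (∀ s, g (Sum.inr s) = jj s) ∧
          ∀ i : Fin N,
            ((ψ r).Realize (Sum.elim (b i) (fun v => b (g v.1) v.2)) ↔ q i = true)

/-- `S_φ(B) ∩ [p]` for an arbitrary set `B` of `β`-tuples. -/
def SetPhiTypes (M : Type*) [L.Structure M] {α β : Type*} (φ : L.Formula (α ⊕ β))
    (p : Set (L.Formula α)) (B : Set (β → M)) : Set ((β → M) → Bool) :=
  { q | (∀ c ∉ B, q c = false) ∧
        ∃ a : α → M, RealizesType p a ∧ ∀ c ∈ B, (q c = true ↔ φ.Realize (Sum.elim a c)) }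

/-- `φ(x;y)` has VC-density `≤ ℓ` with respect to `p`. -/
def VCDensityLE (M : Type*) [L.Structure M] {α β : Type*} (φ : L.Formula (α ⊕ β))
    (p : Set (L.Formula α)) (ℓ : ℝ) : Prop :=
  ∃ K : ℝ, ∀ B : Set (β → M), B.Finite → B.Nonempty →
    ((SetPhiTypes M φ p B).ncard : ℝ) ≤ K * (B.ncard : ℝ) ^ ℓ

/-- `φ(x;y)` has UDTFS-rank `≤ n` with respect to `p`. -/
def UDTFSRankLE (M : Type*) [L.Structure M] {α β : Type*} (φ : L.Formula (α ⊕ β))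
    (p : Set (L.Formula α)) (n : ℕ) : Prop :=
  ∃ (R : ℕ) (ψ : Fin R → L.Formula (β ⊕ Fin n × β)),
    ∀ B : Set (β → M), B.Finite → B.Nonempty →
      ∀ q ∈ SetPhiTypes M φ p B,
        ∃ (r : Fin R) (f : Fin n → β → M), (∀ m, f m ∈ B) ∧
          ∀ c ∈ B, ((ψ r).Realize (Sum.elim c (fun v => f v.1 v.2)) ↔ q c = true)


/-- The family `b` is an indiscernible sequence over the parameters `ρ` (an
enumeration of the parameter set `A`). -/
def IsIndiscernibleOver (L : Language) {M : Type*} [L.Structure M] {γ δ : Type*} (ρ : δ → M)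
    {I : Type*} [LinearOrder I] (b : I → γ → M) : Prop :=
  ∀ (n : ℕ) (ψ : L.Formula ((Fin n × γ) ⊕ δ)) (i j : Fin n → I),
    StrictMono i → StrictMono j →
    (ψ.Realize (Sum.elim (fun v => b (i v.1) v.2) ρ) ↔
      ψ.Realize (Sum.elim (fun v => b (j v.1) v.2) ρ))

/-- The partial type `p(x)` over the parameters `ρ` has dp-rank `≤ n`. -/
def DpRankOverLE (M : Type*) [L.Structure M] {α δ : Type*} (ρ : δ → M)
    (p : Set (L.Formula (α ⊕ δ))) (n : ℕ) : Prop :=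
  ∀ a : α → M, (∀ ψ ∈ p, ψ.Realize (Sum.elim a ρ)) →
    ∀ (γ : Type) (b : ℚ → γ → M), IsIndiscernibleOver L ρ b →
      ∃ C : Finset ℝ, C.card ≤ n ∧ ∀ i j : ℚ, SimRel (↑C) i j →
        ∀ ψ : L.Formula (γ ⊕ (α ⊕ δ)),
          (ψ.Realize (Sum.elim (b i) (Sum.elim a ρ)) ↔
            ψ.Realize (Sum.elim (b j) (Sum.elim a ρ)))

/-- `tp(a / A)`: the complete type of the tuple `a` over the parameters `ρ`
(an enumeration of `A`). -/
def completeTypeOver (L : Language) {M : Type*} [L.Structure M] {α δ : Type*} (a : α → M) (ρ : δ → M) :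
    Set (L.Formula (α ⊕ δ)) :=
  {ψ | ψ.Realize (Sum.elim a ρ)}

/-- The property `g` of rationals is constant on the rationals of some neighbourhood of `c`. -/
def LocConstAt (g : ℚ → Prop) (c : ℝ) : Prop :=
  ∃ u v : ℚ, (u : ℝ) < c ∧ c < v ∧ ∀ p q : ℚ, u < p → p < v → u < q → q < v → (g p ↔ g q)

theorem iff_of_forall_locConstAt {g : ℚ → Prop} {x y : ℚ} (hxy : x ≤ y)
    (h : ∀ c : ℝ, (x : ℝ) ≤ c → c ≤ y → LocConstAt g c) : g x ↔ g y := by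
  have open_nhd : ∀ P : ℚ → Prop, IsOpen {c : ℝ | ∃ u v : ℚ, (u : ℝ) < c ∧ c < v ∧
      ∀ q : ℚ, u < q → q < v → P q} := by
    intro P
    rw [isOpen_iff_mem_nhds]
    rintro c ⟨u, v, hu, hv, H⟩
    filter_upwards [Ioo_mem_nhds hu hv] with d hd
    exact ⟨u, v, hd.1, hd.2, H⟩
  have hx : (x : ℝ) ≤ y := by exact_mod_cast hxy
  by_contra hne
  obtain ⟨z, -, ⟨u, v, hu, hv, H⟩, ⟨u', v', hu', hv', H'⟩⟩ :=
    isPreconnected_Icc (a := (x : ℝ)) (b := y) _ _ (open_nhd fun q => (g q ↔ g x))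
      (open_nhd fun q => (g q ↔ ¬ g x))
      (by
        rintro c ⟨hc, hc'⟩
        obtain ⟨u, v, hu, hv, H⟩ := h c hc hc'
        obtain ⟨p, hp, hp'⟩ := exists_rat_btwn hu
        have hp'' : p < v := by exact_mod_cast hp'.trans hv
        have hp : u < p := by exact_mod_cast hp
        by_cases hg : (g p ↔ g x)
        · exact Or.inl ⟨u, v, hu, hv, fun q h1 h2 => (H q p h1 h2 hp hp'').trans hg⟩
        · refine Or.inr ⟨u, v, hu, hv, fun q h1 h2 => (H q p h1 h2 hp hp'').trans ?_⟩
          tauto)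
      (by
        obtain ⟨u, v, hu, hv, H⟩ := h x le_rfl hx
        exact ⟨x, ⟨le_rfl, hx⟩, u, v, hu, hv, fun q h1 h2 =>
          H q x h1 h2 (by exact_mod_cast hu) (by exact_mod_cast hv)⟩)
      (by
        obtain ⟨u, v, hu, hv, H⟩ := h y hx le_rfl
        refine ⟨y, ⟨hx, le_rfl⟩, u, v, hu, hv, fun q h1 h2 =>
          (H q y h1 h2 (by exact_mod_cast hu) (by exact_mod_cast hv)).trans ?_⟩
        tauto)
  obtain ⟨q, hq, hq'⟩ := exists_rat_btwn (max_lt hu hu')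
  have h1 : u < q := by exact_mod_cast (le_max_left _ _).trans_lt hq
  have h1' : u' < q := by exact_mod_cast (le_max_right _ _).trans_lt hq
  have h2 : q < v := by exact_mod_cast hq'.trans hv
  have h2' : q < v' := by exact_mod_cast hq'.trans hv'
  have e1 := H q h1 h2
  have e2 := H' q h1' h2'
  tauto

/-- The rationals `i` and `j` avoid `C` and lie in the same component of its complement. -/
def SameCut (C : Finset ℝ) (i j : ℚ) : Prop :=
  ∀ c ∈ C, (c < i ∧ c < j) ∨ ((i : ℝ) < c ∧ (j : ℝ) < c)

/-- Around a real `c` there is an order embedding of `ℚ` onto a short interval of rationals whose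
extension to the completions sends a point of `[2l, 2l+1]` to `c`. -/
theorem exists_embedding_near (c : ℝ) (ε : ℚ) (hε : 0 < ε) (l : ℕ) :
    ∃ (φ : ℚ → ℚ) (x : ℝ), StrictMono φ ∧ (∀ q, c - 2 * ε < φ q ∧ φ q < c + 2 * ε) ∧
      (2 * l : ℝ) ≤ x ∧ x ≤ 2 * l + 1 ∧
      ∀ g : ℚ → Prop, LocConstAt (fun q => g (φ q)) x → LocConstAt g c := by
  set e := orderIsoIooNegOneOne ℚ
  have hlt : ((e (2 * l : ℚ) : ℚ)) < e (2 * l + 1 : ℚ) := by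
    have : e (2 * l : ℚ) < e (2 * l + 1 : ℚ) := e.strictMono (by linarith)
    exact this
  have hεr : (0 : ℝ) < ε := by exact_mod_cast hε
  obtain ⟨r, hr, hr'⟩ := exists_rat_btwn
    (show c - ε * ((e (2 * l + 1 : ℚ) : ℚ) : ℝ) < c - ε * ((e (2 * l : ℚ) : ℚ) : ℝ) by
      have : (((e (2 * l : ℚ) : ℚ)) : ℝ) < ((e (2 * l + 1 : ℚ) : ℚ) : ℝ) := by exact_mod_cast hlt
      nlinarith)
  have hb : ∀ q : ℚ, (-1 : ℝ) < ((e q : ℚ) : ℝ) ∧ ((e q : ℚ) : ℝ) < 1 := fun q =>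
    ⟨by exact_mod_cast (e q).2.1, by exact_mod_cast (e q).2.2⟩
  set φ : ℚ → ℚ := fun q => r + ε * (e q : ℚ) with hφ
  have hmono : StrictMono φ := by
    intro p q hpq
    have : (e p : ℚ) < e q := e.strictMono hpq
    simp only [hφ]
    nlinarith
  have hl : ((φ (2 * l) : ℚ) : ℝ) < c := by simp only [hφ]; push_cast; linarith
  have hl' : c < ((φ (2 * l + 1) : ℚ) : ℝ) := by simp only [hφ]; push_cast; linarith
  set S : Set ℝ := {y | ∃ p : ℚ, y = p ∧ ((φ p : ℚ) : ℝ) < c}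
  have hub : ∀ y ∈ S, y ≤ 2 * l + 1 := by
    rintro y ⟨p, rfl, hp⟩
    have : φ p < φ (2 * l + 1) := by exact_mod_cast hp.trans hl'
    exact_mod_cast (hmono.lt_iff_lt.1 this).le
  have hbdd : BddAbove S := ⟨_, hub⟩
  have hmem : (2 * l : ℝ) ∈ S := ⟨2 * l, by push_cast; rfl, hl⟩
  refine ⟨φ, sSup S, hmono, fun q => ?_, le_csSup hbdd hmem, csSup_le ⟨_, hmem⟩ hub, ?_⟩
  · have := hb q
    have h1 := hb (2 * l)
    have h2 := hb (2 * l + 1)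
    simp only [hφ]
    push_cast
    constructor <;> nlinarith
  · rintro g ⟨u, v, hu, hv, H⟩
    refine ⟨φ u, φ v, ?_, ?_, ?_⟩
    · obtain ⟨y, ⟨p, rfl, hp⟩, hy⟩ := exists_lt_of_lt_csSup ⟨_, hmem⟩ hu
      refine lt_trans ?_ hp
      exact_mod_cast hmono (by exact_mod_cast hy)
    · obtain ⟨p, hp, hp'⟩ := exists_rat_btwn hv
      have h1 : c ≤ (φ p : ℚ) := by
        by_contra hcon
        exact absurd (le_csSup hbdd ⟨p, rfl, not_le.1 hcon⟩) (not_le.2 hp)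
      refine h1.trans_lt ?_
      exact_mod_cast hmono (by exact_mod_cast hp')
    · have surj : ∀ q : ℚ, φ u < q → q < φ v → ∃ p, u < p ∧ p < v ∧ φ p = q := by
        intro q h1 h2
        have hu1 := (e u).2.1
        have hv1 := (e v).2.2
        have hy : (q - r) / ε ∈ Set.Ioo (-1 : ℚ) 1 := by
          simp only [hφ] at h1 h2
          constructor
          · rw [lt_div_iff₀ hε]; nlinarith
          · rw [div_lt_iff₀ hε]; nlinarith
        have hq : φ (e.symm ⟨_, hy⟩) = q := by
          simp only [hφ, OrderIso.apply_symm_apply]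
          field_simp
          ring
        exact ⟨_, hmono.lt_iff_lt.1 (h1.trans_eq hq.symm),
          hmono.lt_iff_lt.1 (hq.trans_lt h2), hq⟩
      intro p q h1 h2 h3 h4
      obtain ⟨p, hp, hp', rfl⟩ := surj p h1 h2
      obtain ⟨q, hq, hq', rfl⟩ := surj q h3 h4
      exact H p q hp hp' hq hq'

/-- The points of a finite set `D` have disjoint neighbourhoods avoiding `E`, each an image of `ℚ`
under an embedding `φ c`, such that the `φ c` pull the points of `D` back to distinct reals. -/
theorem exists_disjoint_embeddings (D E : Finset ℝ) (hDE : ∀ c ∈ D, c ∉ E) :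
    ∃ (φ : D → ℚ → ℚ) (x : D → ℝ), (∀ c, StrictMono (φ c)) ∧ Function.Injective x ∧
      (∀ c d : D, (c : ℝ) < d → ∀ p q, φ c p < φ d q) ∧
      (∀ c p q, SameCut E (φ c p) (φ c q)) ∧
      ∀ c (g : ℚ → Prop), LocConstAt (fun q => g (φ c q)) (x c) → LocConstAt g c := by
  obtain ⟨ε, hε, hsep⟩ : ∃ ε : ℚ, 0 < ε ∧ ∀ c ∈ D ∪ E, ∀ d ∈ D ∪ E, c < d →
      c + 4 * (ε : ℝ) ≤ d := by
    have hfin : ∀ s : Finset (ℝ × ℝ), ∃ ε : ℚ, 0 < ε ∧ ∀ z ∈ s, z.1 < z.2 →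
        z.1 + 4 * (ε : ℝ) ≤ z.2 := by
      intro s
      induction s using Finset.induction_on with
      | empty => exact ⟨1, one_pos, by simp⟩
      | insert z s _ ih =>
        obtain ⟨ε, hε, H⟩ := ih
        by_cases hz : z.1 < z.2
        · obtain ⟨η, hη, hη'⟩ := exists_rat_btwn (show (0 : ℝ) < (z.2 - z.1) / 4 by linarith)
          have hη0 : 0 < η := by exact_mod_cast hη
          refine ⟨min ε η, lt_min hε hη0, ?_⟩
          have h1 : ((min ε η : ℚ) : ℝ) ≤ ε := by exact_mod_cast min_le_left ε η
          have h2 : ((min ε η : ℚ) : ℝ) ≤ η := by exact_mod_cast min_le_right ε η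
          intro w hw hlt
          rcases Finset.mem_insert.1 hw with rfl | hw
          · linarith
          · linarith [H w hw hlt]
        · refine ⟨ε, hε, fun w hw hlt => ?_⟩
          rcases Finset.mem_insert.1 hw with rfl | hw
          · exact absurd hlt hz
          · exact H w hw hlt
    obtain ⟨ε, hε, H⟩ := hfin ((D ∪ E) ×ˢ (D ∪ E))
    exact ⟨ε, hε, fun c hc d hd => H (c, d) (Finset.mk_mem_product hc hd)⟩
  choose φ x hmono hnear hx hx' hloc using
    fun c : D => exists_embedding_near (c : ℝ) ε hε (D.equivFin c)
  refine ⟨φ, x, hmono, ?_, ?_, ?_, hloc⟩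
  · intro c d hcd
    apply D.equivFin.injective
    have h1 := hx c
    have h2 := hx' d
    have h3 := hx d
    have h4 := hx' c
    rw [hcd] at h1 h4
    have h5 : (2 * (D.equivFin c : ℕ)) ≤ 2 * (D.equivFin d : ℕ) + 1 := by exact_mod_cast h1.trans h2
    have h6 : (2 * (D.equivFin d : ℕ)) ≤ 2 * (D.equivFin c : ℕ) + 1 := by exact_mod_cast h3.trans h4
    ext
    omega
  · intro c d hcd p q
    have := hsep c (Finset.mem_union_left _ c.2) d (Finset.mem_union_left _ d.2) hcd
    have h1 := (hnear c p).2
    have h2 := (hnear d q).1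
    have : ((φ c p : ℚ) : ℝ) < φ d q := by linarith
    exact_mod_cast this
  · intro c p q e he
    have hc := Finset.mem_union_left E c.2
    have he' := Finset.mem_union_right D he
    have hp := hnear c p
    have hq := hnear c q
    rcases lt_trichotomy (c : ℝ) e with h | h | h
    · have := hsep _ hc _ he' h
      exact Or.inr ⟨by linarith [hp.2, (by exact_mod_cast hε : (0:ℝ) < ε)], by
        linarith [hq.2, (by exact_mod_cast hε : (0:ℝ) < ε)]⟩
    · exact absurd (h ▸ he) (hDE c c.2)
    · have := hsep _ he' _ hc h
      exact Or.inl ⟨by linarith [hp.1, (by exact_mod_cast hε : (0:ℝ) < ε)], by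
        linarith [hq.1, (by exact_mod_cast hε : (0:ℝ) < ε)]⟩

/-- The pieces into which `E` cuts `b` are mutually indiscernible over the parameters `σ`. -/
def MutuallyIndiscernible (L : Language) {M : Type*} [L.Structure M] {γ ε : Type*}
    (b : ℚ → γ → M) (σ : ε → M) (E : Finset ℝ) : Prop :=
  ∀ (ι : Type) [Finite ι] (u v : ι → ℚ), (∀ x y, u x < u y ↔ v x < v y) →
    (∀ x, SameCut E (u x) (v x)) → ∀ ψ : L.Formula ((ι × γ) ⊕ ε),
      (ψ.Realize (Sum.elim (fun z => b (u z.1) z.2) σ) ↔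
        ψ.Realize (Sum.elim (fun z => b (v z.1) z.2) σ))

theorem exists_strictMono_factorization {ι : Type*} [Finite ι] (u v : ι → ℚ)
    (h : ∀ x y, u x < u y ↔ v x < v y) :
    ∃ (n : ℕ) (i j : Fin n → ℚ) (r : ι → Fin n), StrictMono i ∧ StrictMono j ∧
      (∀ x, i (r x) = u x) ∧ (∀ x, j (r x) = v x) ∧ Function.Surjective r := by
  classical
  have := Fintype.ofFinite ι
  have heq : ∀ x y, u x = u y → v x = v y := fun x y hxy =>
    le_antisymm (not_lt.1 fun hlt => ((h _ _).2 hlt).ne hxy.symm)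
      (not_lt.1 fun hlt => ((h _ _).2 hlt).ne hxy)
  set s := Finset.univ.image u
  set e := s.orderIsoOfFin rfl
  have hs : ∀ m, ∃ x, u x = e m := fun m => by
    obtain ⟨x, -, hx⟩ := Finset.mem_image.1 (e m).2
    exact ⟨x, hx⟩
  choose w hw using hs
  refine ⟨s.card, fun m => e m, fun m => v (w m),
    fun x => e.symm ⟨u x, Finset.mem_image_of_mem u (Finset.mem_univ x)⟩,
    fun m m' hm => e.strictMono hm, fun m m' hm => ?_, fun x => by simp, fun x => ?_, fun m => ?_⟩
  · refine (h _ _).1 ?_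
    rw [hw, hw]
    exact e.strictMono hm
  · exact heq _ _ (by rw [hw]; simp)
  · exact ⟨w m, by rw [OrderIso.symm_apply_eq]; exact Subtype.ext (hw m)⟩

theorem mutuallyIndiscernible_of_strictMono {M : Type*} [L.Structure M] {γ ε : Type*}
    {b : ℚ → γ → M} {σ : ε → M} {E : Finset ℝ}
    (h : ∀ (n : ℕ) (i j : Fin n → ℚ), StrictMono i → StrictMono j →
      (∀ m, SameCut E (i m) (j m)) → ∀ ψ : L.Formula ((Fin n × γ) ⊕ ε),
      (ψ.Realize (Sum.elim (fun z => b (i z.1) z.2) σ) ↔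
        ψ.Realize (Sum.elim (fun z => b (j z.1) z.2) σ))) :
    MutuallyIndiscernible L b σ E := by
  intro ι _ u v huv hE ψ
  obtain ⟨n, i, j, r, hi, hj, hu, hv, hr⟩ := exists_strictMono_factorization u v huv
  have hE' : ∀ m, SameCut E (i m) (j m) := fun m => by
    obtain ⟨x, rfl⟩ := hr m
    rw [hu, hv]
    exact hE x
  have key := h n i j hi hj hE' (ψ.relabel (Sum.map (Prod.map r id) id))
  simp only [Formula.realize_relabel] at key
  convert key using 2
  · funext z
    rcases z with z | z <;> simp [hu]
  · funext z
    rcases z with z | z <;> simp [hv]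

/-- An indiscernible sequence remains piecewise mutually indiscernible over finitely many of its
members. -/
theorem IsIndiscernibleOver.mutuallyIndiscernible {M : Type*} [L.Structure M] {γ δ : Type*}
    {b : ℚ → γ → M} {ρ : δ → M} (h : IsIndiscernibleOver L ρ b) (F : Finset ℚ) :
    MutuallyIndiscernible L b (Sum.elim (fun z : F × γ => b z.1 z.2) ρ)
      (F.image (fun q : ℚ => (q : ℝ))) := by
  have h0 : MutuallyIndiscernible L b ρ ∅ :=
    mutuallyIndiscernible_of_strictMono fun n i j hi hj _ ψ => h n ψ i j hi hj
  intro ι _ u v huv hE ψ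
  have hF : ∀ (x : ι) (f : F), ((f : ℚ) < u x ↔ (f : ℚ) < v x) ∧ (u x < f ↔ v x < f) := by
    intro x f
    have := hE x f (Finset.mem_image_of_mem _ f.2)
    simp only [Rat.cast_lt] at this
    rcases this with h | h
    · exact ⟨iff_of_true h.1 h.2, iff_of_false h.1.not_gt h.2.not_gt⟩
    · exact ⟨iff_of_false h.1.not_gt h.2.not_gt, iff_of_true h.1 h.2⟩
  have key := h0 (ι ⊕ F) (Sum.elim u (fun f => (f : ℚ))) (Sum.elim v (fun f => (f : ℚ)))
    (by
      rintro (x | f) (y | f')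
      · exact huv x y
      · exact (hF x f').2
      · exact (hF y f).1
      · exact Iff.rfl)
    (fun _ c hc => absurd hc (Finset.notMem_empty c))
    (ψ.relabel (Sum.elim (fun z => Sum.inl (Sum.inl z.1, z.2))
      (Sum.elim (fun z => Sum.inl (Sum.inr z.1, z.2)) Sum.inr)))
  simp only [Formula.realize_relabel] at key
  convert key using 2 <;>
  · funext z
    rcases z with z | z | z <;> rfl

/-- The conclusion of `DpRankOverLE` for a single tuple `a`. -/
def TupleDpRankLE (L : Language) {M : Type*} [L.Structure M] {α δ : Type*} (ρ : δ → M) (a : α → M)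
    (n : ℕ) : Prop :=
  ∀ (γ : Type) (b : ℚ → γ → M), IsIndiscernibleOver L ρ b →
    ∃ C : Finset ℝ, C.card ≤ n ∧ ∀ i j : ℚ, SimRel (↑C) i j →
      ∀ ψ : L.Formula (γ ⊕ (α ⊕ δ)),
        (ψ.Realize (Sum.elim (b i) (Sum.elim a ρ)) ↔ ψ.Realize (Sum.elim (b j) (Sum.elim a ρ)))

theorem exists_rat_isolating (S : Finset ℝ) (e : ℝ) (he : e ∉ S) :
    ∃ u v : ℚ, (u : ℝ) < e ∧ e < v ∧ ∀ s ∈ S, s < u ∨ v < s := by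
  obtain ⟨l, r, hlr, hsub⟩ := mem_nhds_iff_exists_Ioo_subset.1
    (S.finite_toSet.isClosed.isOpen_compl.mem_nhds he)
  obtain ⟨u, hlu, hue⟩ := exists_rat_btwn hlr.1
  obtain ⟨v, hev, hvr⟩ := exists_rat_btwn hlr.2
  refine ⟨u, v, hue, hev, fun s hs => ?_⟩
  by_contra! hcon
  exact hsub ⟨hlu.trans_le hcon.1, hcon.2.trans_lt hvr⟩ hs

theorem locConstAt_of_simRel {C : Finset ℝ} {g : ℚ → Prop}
    (h : ∀ i j : ℚ, SimRel (↑C) i j → (g i ↔ g j)) {c : ℝ} (hc : c ∉ C) : LocConstAt g c := by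
  obtain ⟨u, v, huc, hcv, huv⟩ := exists_rat_isolating C c hc
  refine ⟨u, v, huc, hcv, fun p q h1 h2 h3 h4 => h p q fun d hd => ?_⟩
  have h1' : (u : ℝ) < p := by exact_mod_cast h1
  have h2' : (p : ℝ) < v := by exact_mod_cast h2
  have h3' : (u : ℝ) < q := by exact_mod_cast h3
  have h4' : (q : ℝ) < v := by exact_mod_cast h4
  rcases huv d hd with hd' | hd'
  · exact ⟨iff_of_true (by linarith) (by linarith), iff_of_false (by linarith) (by linarith)⟩
  · exact ⟨iff_of_false (by linarith) (by linarith), iff_of_true (by linarith) (by linarith)⟩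

/-- If the pieces of `b` cut by `E` are mutually indiscernible over `θ` and `ρ`, then outside `E`
the type of `b q` over `θ`, `a` and `ρ` changes at no more points than the dp-rank of `a`. -/
theorem TupleDpRankLE.card_le {M : Type*} [L.Structure M] {α δ : Type*} {γ κ : Type}
    {ρ : δ → M} {a : α → M} {k : ℕ} (h : TupleDpRankLE L ρ a k) {b : ℚ → γ → M} {θ : κ → M}
    {D E : Finset ℝ} (hDE : ∀ c ∈ D, c ∉ E) (hb : MutuallyIndiscernible L b (Sum.elim θ ρ) E)
    (hD : ∀ c ∈ D, ∃ ψ : L.Formula (γ ⊕ (κ ⊕ (α ⊕ δ))), ¬ LocConstAt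
      (fun q => ψ.Realize (Sum.elim (b q) (Sum.elim θ (Sum.elim a ρ)))) c) : D.card ≤ k := by
  obtain ⟨φ, x, hmono, hinj, hlt, hcut, hloc⟩ := exists_disjoint_embeddings D E hDE
  obtain ⟨C, hCk, hC⟩ := h ((D × γ) ⊕ κ) (fun q => Sum.elim (fun z => b (φ z.1 q) z.2) θ) (by
    intro n ψ i j hi hj
    have key := hb (Fin n × D) (fun z => φ z.2 (i z.1)) (fun z => φ z.2 (j z.1))
      (by
        rintro ⟨m, c⟩ ⟨m', c'⟩
        rcases lt_trichotomy (c : ℝ) c' with hc | hc | hc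
        · exact iff_of_true (hlt _ _ hc _ _) (hlt _ _ hc _ _)
        · obtain rfl := Subtype.ext hc
          simp only [(hmono c).lt_iff_lt, hi.lt_iff_lt, hj.lt_iff_lt]
        · exact iff_of_false (hlt _ _ hc _ _).not_gt (hlt _ _ hc _ _).not_gt)
      (fun z => hcut z.2 _ _)
      (ψ.relabel (Sum.elim (fun z => Sum.elim (fun w => Sum.inl ((z.1, w.1), w.2))
        (fun w => Sum.inr (Sum.inl w)) z.2) (fun z => Sum.inr (Sum.inr z))))
    simp only [Formula.realize_relabel] at key
    convert key using 2 <;>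
    · funext z
      rcases z with ⟨z, z' | z'⟩ | z <;> rfl)
  refine le_trans ?_ hCk
  rw [← Finset.card_attach, ← Finset.card_image_of_injective _ hinj]
  refine Finset.card_le_card fun y hy => ?_
  obtain ⟨c, -, rfl⟩ := Finset.mem_image.1 hy
  by_contra hcon
  obtain ⟨ψ, hψ⟩ := hD c c.2
  refine hψ (hloc c _ ?_)
  have key := locConstAt_of_simRel (fun i j hij => hC i j hij
    (ψ.relabel (Sum.elim (fun z => Sum.inl (Sum.inl (c, z)))
      (Sum.elim (fun z => Sum.inl (Sum.inr z)) Sum.inr)))) hcon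
  simp only [Formula.realize_relabel] at key
  convert key using 3
  funext z
  rcases z with z | z | z <;> rfl

/-- Some formula over `τ` and the members of `b` indexed by `G` changes its truth value on `b q`
arbitrarily close to `q = c`. -/
def ChangesAt (L : Language) {M : Type*} [L.Structure M] {γ ε : Type*} (b : ℚ → γ → M)
    (τ : ε → M) (G : Finset ℚ) (c : ℝ) : Prop :=
  ∃ ψ : L.Formula (γ ⊕ ((G × γ) ⊕ ε)), ¬ LocConstAt (fun q => ψ.Realize
    (Sum.elim (b q) (Sum.elim (fun z => b z.1 z.2) τ))) c

theorem changesAt_of_not_locConstAt {M : Type*} [L.Structure M] {γ ε ν : Type*} {b : ℚ → γ → M}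
    {τ : ε → M} {G : Finset ℚ} {c : ℝ} (w : ℚ → ν → M)
    (hw : ∀ y, (∃ x, ∀ q, w q y = b q x) ∨ (∃ g ∈ G, ∃ x, ∀ q, w q y = b g x) ∨
      ∃ e, ∀ q, w q y = τ e)
    (ψ : L.Formula ν) (hψ : ¬ LocConstAt (fun q => ψ.Realize (w q)) c) :
    ChangesAt L b τ G c := by
  have : ∀ y, ∃ z : γ ⊕ ((G × γ) ⊕ ε), ∀ q, w q y =
      Sum.elim (b q) (Sum.elim (fun z : G × γ => b z.1 z.2) τ) z := by
    intro y
    rcases hw y with ⟨x, hx⟩ | ⟨g, hg, x, hx⟩ | ⟨e, he⟩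
    · exact ⟨Sum.inl x, hx⟩
    · exact ⟨Sum.inr (Sum.inl (⟨g, hg⟩, x)), hx⟩
    · exact ⟨Sum.inr (Sum.inr e), he⟩
  choose f hf using this
  refine ⟨ψ.relabel f, fun hloc => hψ ?_⟩
  simp only [Formula.realize_relabel] at hloc
  convert hloc using 3
  funext y
  exact hf y _

theorem ChangesAt.mono {M : Type*} [L.Structure M] {γ ε : Type*} {b : ℚ → γ → M}
    {τ : ε → M} {G H : Finset ℚ} {c : ℝ} (h : ChangesAt L b τ G c) (hGH : G ⊆ H) :
    ChangesAt L b τ H c := by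
  obtain ⟨ψ, hψ⟩ := h
  refine changesAt_of_not_locConstAt _ ?_ ψ hψ
  rintro (x | ⟨g, x⟩ | e)
  · exact Or.inl ⟨x, fun _ => rfl⟩
  · exact Or.inr (Or.inl ⟨g, hGH g.2, x, fun _ => rfl⟩)
  · exact Or.inr (Or.inr ⟨e, fun _ => rfl⟩)

/-- Over members of `b` outside `C`, all changes of type happen in `C`. -/
def ControlsChanges (L : Language) {M : Type*} [L.Structure M] {γ ε : Type*} (b : ℚ → γ → M)
    (τ : ε → M) (C : Finset ℝ) : Prop :=
  ∀ G : Finset ℚ, (∀ g ∈ G, (g : ℝ) ∉ C) → ∀ c ∉ C, (∀ g ∈ G, (g : ℝ) ≠ c) →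
    ¬ ChangesAt L b τ G c

/-- A point of a minimal controlling set witnesses a change over members of `b` outside that set. -/
theorem ControlsChanges.exists_changesAt {M : Type*} [L.Structure M] {γ ε : Type*} {b : ℚ → γ → M}
    {τ : ε → M} {C : Finset ℝ} (hC : ControlsChanges L b τ C) {c : ℝ} (hc : c ∈ C)
    (hmin : ¬ ControlsChanges L b τ (C.erase c)) :
    ∃ F : Finset ℚ, (∀ f ∈ F, (f : ℝ) ∉ C) ∧ ChangesAt L b τ F c := by
  classical
  unfold ControlsChanges at hmin
  push Not at hmin
  obtain ⟨G, hG, d, hd, hGd, ψ, hψ⟩ := hmin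
  by_contra hcon
  push Not at hcon
  by_cases hcG : ∀ g ∈ G, (g : ℝ) ≠ c
  · have hGC : ∀ g ∈ G, (g : ℝ) ∉ C := fun g hg hgC =>
      hG g hg (Finset.mem_erase.2 ⟨hcG g hg, hgC⟩)
    by_cases hdc : d = c
    · exact hcon G hGC (hdc ▸ ⟨ψ, hψ⟩)
    · exact hC G hGC d (fun hdC => hd (Finset.mem_erase.2 ⟨hdc, hdC⟩)) hGd ⟨ψ, hψ⟩
  push Not at hcG
  obtain ⟨g, hg, rfl⟩ := hcG
  have hdg : d ≠ g := (hGd g hg).symm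
  have hdC : d ∉ C := fun hdC => hd (Finset.mem_erase.2 ⟨hdg, hdC⟩)
  have hG' : ∀ f ∈ G.erase g, (f : ℝ) ∉ C := fun f hf hfC =>
    hG f (Finset.mem_of_mem_erase hf)
      (Finset.mem_erase.2 ⟨by exact_mod_cast Finset.ne_of_mem_erase hf, hfC⟩)
  have hins : ∀ p : ℚ, (p : ℝ) ∉ C → ∀ f ∈ insert p (G.erase g), (f : ℝ) ∉ C := by
    intro p hp f hf
    rcases Finset.mem_insert.1 hf with rfl | hf
    · exact hp
    · exact hG' f hf
  set w : ℚ → ℚ → γ ⊕ ((G × γ) ⊕ ε) → M := fun q p => Sum.elim (b q)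
    (Sum.elim (fun z => b (if (z.1 : ℚ) = g then p else z.1) z.2) τ) with hw
  -- `w q p` substitutes `b q` for the main variable and `b p` for the parameter `b g`
  have hwq : ∀ p e, ¬ LocConstAt (fun q => ψ.Realize (w q p)) e →
      ChangesAt L b τ (insert p (G.erase g)) e := by
    intro p e
    refine changesAt_of_not_locConstAt _ ?_ ψ
    rintro (x | ⟨f, x⟩ | e)
    · exact Or.inl ⟨x, fun _ => rfl⟩
    · refine Or.inr (Or.inl ⟨if (f : ℚ) = g then p else f, ?_, x, fun _ => rfl⟩)
      split_ifs with hf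
      · exact Finset.mem_insert_self _ _
      · exact Finset.mem_insert_of_mem (Finset.mem_erase.2 ⟨hf, f.2⟩)
    · exact Or.inr (Or.inr ⟨e, fun _ => rfl⟩)
  have hwp : ∀ q e, ¬ LocConstAt (fun p => ψ.Realize (w q p)) e →
      ChangesAt L b τ (insert q (G.erase g)) e := by
    intro q e
    refine changesAt_of_not_locConstAt _ ?_ ψ
    rintro (x | ⟨f, x⟩ | e)
    · exact Or.inr (Or.inl ⟨q, Finset.mem_insert_self _ _, x, fun _ => rfl⟩)
    · by_cases hf : (f : ℚ) = g
      · exact Or.inl ⟨x, fun _ => by simp [hw, hf]⟩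
      · exact Or.inr (Or.inl ⟨f, Finset.mem_insert_of_mem (Finset.mem_erase.2 ⟨hf, f.2⟩), x,
          fun _ => by simp [hw, hf]⟩)
    · exact Or.inr (Or.inr ⟨e, fun _ => rfl⟩)
  obtain ⟨u, v, hu, hv, huv⟩ := exists_rat_isolating (C ∪ G.image (fun q : ℚ => (q : ℝ))) d (by
    simp only [Finset.mem_union, Finset.mem_image, not_or]
    exact ⟨hdC, fun ⟨f, hf, hfd⟩ => hGd f hf hfd⟩)
  have hCuv : ∀ s ∈ C, s < u ∨ v < s := fun s hs => huv s (Finset.mem_union_left _ hs)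
  have hGuv : ∀ f ∈ G, (f : ℝ) < u ∨ (v : ℝ) < f := fun f hf =>
    huv f (Finset.mem_union_right _ (Finset.mem_image_of_mem _ hf))
  have hguv := hGuv g hg
  have huv_lt : (u : ℝ) < v := hu.trans hv
  obtain ⟨u', v', hu', hv', huv'⟩ := exists_rat_isolating
    ({(u : ℝ), (v : ℝ)} ∪ (C ∪ G.image (fun q : ℚ => (q : ℝ))).erase g) g (by
      simp only [Finset.mem_union, Finset.mem_insert, Finset.mem_singleton, not_or]
      exact ⟨⟨by rcases hguv with h | h <;> linarith, by rcases hguv with h | h <;> linarith⟩,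
        Finset.notMem_erase _ _⟩)
  have hu_out := huv' u (by simp)
  have hv_out := huv' v (by simp)
  have hCuv' : ∀ s ∈ C, s ≠ g → s < u' ∨ v' < s := fun s hs hsg =>
    huv' s (Finset.mem_union_right _ (Finset.mem_erase.2 ⟨hsg, Finset.mem_union_left _ hs⟩))
  have hGuv' : ∀ f ∈ G.erase g, (f : ℝ) < u' ∨ (v' : ℝ) < f := fun f hf =>
    huv' f (Finset.mem_union_right _ (Finset.mem_erase.2
      ⟨by exact_mod_cast Finset.ne_of_mem_erase hf,
        Finset.mem_union_right _ (Finset.mem_image_of_mem _ (Finset.mem_of_mem_erase hf))⟩))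
  have hsep : ∀ s t : ℝ, u < s → s < v → u' < t → t < v' → s ≠ t := by
    rintro s _ h1 h2 h3 h4 rfl
    rcases hguv with h | h <;> rcases hu_out with h' | h' <;> rcases hv_out with h'' | h'' <;>
      linarith
  obtain ⟨p, hgp, hpv⟩ := exists_rat_btwn hv'
  have hpC : (p : ℝ) ∉ C := fun hp => by
    rcases hCuv' p hp hgp.ne' with h | h <;> linarith
  have move_param : ∀ q : ℚ, u < q → q < v → (ψ.Realize (w q g) ↔ ψ.Realize (w q p)) := by
    intro q h1 h2
    have h1' : (u : ℝ) < q := by exact_mod_cast h1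
    have h2' : (q : ℝ) < v := by exact_mod_cast h2
    have hqC : (q : ℝ) ∉ C := fun hq => by
      rcases hCuv q hq with h | h <;> linarith
    refine iff_of_forall_locConstAt (g := fun p => ψ.Realize (w q p))
      (by exact_mod_cast hgp.le) fun e he he' => ?_
    by_contra hloc
    have hch := hwp q e hloc
    by_cases heg : e = g
    · exact hcon _ (hins q hqC) (heg ▸ hch)
    · refine hC _ (hins q hqC) e (fun heC => ?_) (fun f hf => ?_) hch
      · rcases hCuv' e heC heg with h | h <;> linarith
      · rcases Finset.mem_insert.1 hf with rfl | hf
        · exact hsep _ _ h1' h2' (by linarith) (by linarith)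
        · rcases hGuv' f hf with h | h
          · exact (by linarith : (f : ℝ) < e).ne
          · exact (by linarith : e < (f : ℝ)).ne'
  have move_main : ∀ q q' : ℚ, u < q → q ≤ q' → q' < v →
      (ψ.Realize (w q p) ↔ ψ.Realize (w q' p)) := by
    intro q q' h1 h2 h3
    have h1' : (u : ℝ) < q := by exact_mod_cast h1
    have h3' : (q' : ℝ) < v := by exact_mod_cast h3
    refine iff_of_forall_locConstAt (g := fun q => ψ.Realize (w q p)) h2 fun e he he' => ?_
    by_contra hloc
    refine hC _ (hins p hpC) e (fun heC => ?_) (fun f hf => ?_) (hwq p e hloc)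
    · rcases hCuv e heC with h | h <;> linarith
    · rcases Finset.mem_insert.1 hf with rfl | hf
      · exact (hsep _ _ (by linarith) (by linarith) (by linarith) hpv).symm
      · rcases hGuv f (Finset.mem_of_mem_erase hf) with h | h
        · exact (by linarith : (f : ℝ) < e).ne
        · exact (by linarith : e < (f : ℝ)).ne'
  have hwg : ∀ q, w q g = Sum.elim (b q) (Sum.elim (fun z : G × γ => b z.1 z.2) τ) := by
    intro q
    funext z
    rcases z with z | ⟨f, z⟩ | z
    · rfl
    · by_cases hf : (f : ℚ) = g <;> simp [hw, hf]
    · rfl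
  refine hψ ⟨u, v, hu, hv, fun q q' h1 h2 h3 h4 => ?_⟩
  beta_reduce
  rw [← hwg, ← hwg, move_param q h1 h2, move_param q' h3 h4]
  rcases le_total q q' with h | h
  · exact move_main q q' h1 h h4
  · exact (move_main q' q h3 h h2).symm

/-- If `k` bounds the number of points at which types change over finitely many members of `b`
indexed elsewhere, then some set of at most `k` points controls all changes. -/
theorem exists_controlsChanges {M : Type*} [L.Structure M] {γ ε : Type*} {b : ℚ → γ → M}
    {τ : ε → M} {k : ℕ}
    (h : ∀ (D : Finset ℝ) (F : Finset ℚ), (∀ f ∈ F, (f : ℝ) ∉ D) →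
      (∀ c ∈ D, ChangesAt L b τ F c) → D.card ≤ k) :
    ∃ C : Finset ℝ, C.card ≤ k ∧ ControlsChanges L b τ C := by
  classical
  have hfin : ∃ C : Finset ℝ, ControlsChanges L b τ C := by
    set P : ℕ → Prop := fun n => ∃ (D : Finset ℝ) (F : Finset ℚ), D.card = n ∧
      (∀ f ∈ F, (f : ℝ) ∉ D) ∧ ∀ c ∈ D, ChangesAt L b τ F c
    have hP0 : P 0 := ⟨∅, ∅, by simp⟩
    obtain ⟨D, F, hcard, hFD, hD⟩ := Nat.findGreatest_spec (P := P) (Nat.zero_le k) hP0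
    refine ⟨D ∪ F.image (fun q : ℚ => (q : ℝ)), fun G hG c hc hGc hch => ?_⟩
    simp only [Finset.mem_union, Finset.mem_image, not_or, not_exists, not_and] at hG hc
    have hdisj : ∀ f ∈ F ∪ G, (f : ℝ) ∉ insert c D := by
      intro f hf hfc
      rcases Finset.mem_union.1 hf with hf | hf <;> rcases Finset.mem_insert.1 hfc with hfc | hfc
      · exact hc.2 f hf hfc
      · exact hFD f hf hfc
      · exact hGc f hf hfc
      · exact (hG f hf).1 hfc
    have hch' : ∀ d ∈ insert c D, ChangesAt L b τ (F ∪ G) d := by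
      intro d hd
      rcases Finset.mem_insert.1 hd with rfl | hd
      · exact hch.mono Finset.subset_union_right
      · exact (hD d hd).mono Finset.subset_union_left
    have hlt : D.card + 1 ≤ k := by
      rw [← Finset.card_insert_of_notMem hc.1]
      exact h _ _ hdisj hch'
    refine Nat.findGreatest_is_greatest (P := P) (n := k) (k := D.card + 1) (by omega) hlt
      ⟨insert c D, F ∪ G, Finset.card_insert_of_notMem hc.1, hdisj, hch'⟩
  obtain ⟨C₀, hC₀⟩ := hfin
  obtain ⟨C, -, hC, hmin⟩ :=
    exists_minimal_le_of_wellFoundedLT (ControlsChanges L b τ) C₀ hC₀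
  have hex : ∀ c : C, ∃ F : Finset ℚ, (∀ f ∈ F, (f : ℝ) ∉ C) ∧ ChangesAt L b τ F c := fun c =>
    hC.exists_changesAt c.2 fun hcon =>
      Finset.notMem_erase (c : ℝ) C (hmin hcon (Finset.erase_subset _ _) c.2)
  choose F hF hF' using hex
  refine ⟨C, h C (Finset.univ.biUnion F) (fun f hf => ?_) (fun c hc => ?_), hC⟩
  · obtain ⟨c, -, hf⟩ := Finset.mem_biUnion.1 hf
    exact hF c f hf
  · exact (hF' ⟨c, hc⟩).mono (Finset.subset_biUnion_of_mem F (Finset.mem_univ _))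

theorem SameCut.sup_right {C : Finset ℝ} {i j : ℚ} (h : SameCut C i j) :
    SameCut C i (i ⊔ j) := by
  rcases le_total i j with hij | hij
  · rwa [sup_eq_right.2 hij]
  · rw [sup_eq_left.2 hij]
    exact fun c hc => (h c hc).imp (fun h => ⟨h.1, h.1⟩) (fun h => ⟨h.1, h.1⟩)

theorem SameCut.symm {C : Finset ℝ} {i j : ℚ} (h : SameCut C i j) : SameCut C j i :=
  fun c hc => (h c hc).imp And.symm And.symm

theorem ControlsChanges.mutuallyIndiscernible {M : Type*} [L.Structure M] {γ ε : Type*}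
    {b : ℚ → γ → M} {τ : ε → M} {C : Finset ℝ} (hC : ControlsChanges L b τ C) :
    MutuallyIndiscernible L b τ C := by
  classical
  have of_le : ∀ (n : ℕ) (i j : Fin n → ℚ), StrictMono i → StrictMono j → i ≤ j →
      (∀ m, SameCut C (i m) (j m)) → ∀ ψ : L.Formula ((Fin n × γ) ⊕ ε),
      (ψ.Realize (Sum.elim (fun z => b (i z.1) z.2) τ) ↔
        ψ.Realize (Sum.elim (fun z => b (j z.1) z.2) τ)) := by
    intro n i j hi hj hij hcut ψ
    -- replace the coordinates of `i` by those of `j` one at a time, from the top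
    have step : ∀ t : ℕ, t ≤ n →
        (ψ.Realize (Sum.elim (fun z : Fin n × γ => b (if (z.1 : ℕ) < t then i z.1 else j z.1) z.2) τ)
          ↔ ψ.Realize (Sum.elim (fun z => b (j z.1) z.2) τ)) := by
      intro t
      induction t with
      | zero => simp
      | succ t ih =>
        intro ht
        rw [← ih (by omega)]
        set m : Fin n := ⟨t, by omega⟩ with hm
        set w : ℚ → (Fin n × γ) ⊕ ε → M := fun q => Sum.elim (fun z => b (if z.1 = m then q else
          if (z.1 : ℕ) < t then i z.1 else j z.1) z.2) τ with hw
        have hwi : w (i m) = Sum.elim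
            (fun z : Fin n × γ => b (if (z.1 : ℕ) < t + 1 then i z.1 else j z.1) z.2) τ := by
          simp only [hw]
          congr! 3 with z
          grind
        have hwj : w (j m) = Sum.elim
            (fun z : Fin n × γ => b (if (z.1 : ℕ) < t then i z.1 else j z.1) z.2) τ := by
          simp only [hw]
          congr! 3 with z
          grind
        rw [← hwi, ← hwj]
        refine iff_of_forall_locConstAt (g := fun q => ψ.Realize (w q)) (hij m) fun c hc hc' => ?_
        by_contra hloc
        refine hC ((Finset.univ.erase m).image fun l : Fin n => if (l : ℕ) < t then i l else j l)
          ?_ c ?_ ?_ (changesAt_of_not_locConstAt w ?_ ψ hloc)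
        · intro g hg hgC
          obtain ⟨l, -, rfl⟩ := Finset.mem_image.1 hg
          rcases hcut l _ hgC with h | h <;> split_ifs at h <;> simp at h
        · intro hcC
          rcases hcut m c hcC with h | h <;> linarith
        · intro g hg hgc
          obtain ⟨l, hl, rfl⟩ := Finset.mem_image.1 hg
          have hlm : (l : ℕ) ≠ t := fun h => Finset.ne_of_mem_erase hl (Fin.ext h)
          rw [← hgc] at hc hc'
          split_ifs at hc hc' with hlt
          · have : i l < i m := hi (Fin.lt_def.2 hlt)
            exact absurd hc (by exact_mod_cast this.not_ge)
          · have : j m < j l := hj (Fin.lt_def.2 (by simp only [hm]; omega))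
            exact absurd hc' (by exact_mod_cast this.not_ge)
        · rintro (⟨l, x⟩ | e)
          · by_cases hl : l = m
            · exact Or.inl ⟨x, fun q => by simp [hw, hl]⟩
            · exact Or.inr (Or.inl ⟨_, Finset.mem_image_of_mem _
                (Finset.mem_erase.2 ⟨hl, Finset.mem_univ l⟩), x, fun q => by simp [hw, hl]⟩)
          · exact Or.inr (Or.inr ⟨e, fun _ => rfl⟩)
    simpa using step n le_rfl
  refine mutuallyIndiscernible_of_strictMono fun n i j hi hj hcut ψ => ?_
  have hsup : StrictMono (i ⊔ j) := fun x y hxy => max_lt_max (hi hxy) (hj hxy)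
  rw [of_le n i (i ⊔ j) hi hsup le_sup_left (fun m => (hcut m).sup_right) ψ,
    of_le n j (i ⊔ j) hj hsup le_sup_right (fun m => by
      rw [Pi.sup_apply, sup_comm]
      exact (hcut m).symm.sup_right) ψ]

theorem TupleDpRankLE.exists_mutuallyIndiscernible {M : Type*} [L.Structure M] {α δ : Type*}
    {γ : Type} {ρ : δ → M} {a : α → M} {k : ℕ} (h : TupleDpRankLE L ρ a k) {b : ℚ → γ → M}
    (hb : IsIndiscernibleOver L ρ b) :
    ∃ C : Finset ℝ, C.card ≤ k ∧ MutuallyIndiscernible L b (Sum.elim a ρ) C := by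
  classical
  obtain ⟨C, hCk, hC⟩ := exists_controlsChanges (L := L) (b := b) (τ := Sum.elim a ρ) (k := k)
    fun D F hFD hD => h.card_le (E := F.image (fun q : ℚ => (q : ℝ)))
      (θ := fun z : F × γ => b z.1 z.2) (fun c hc hcF => by
        obtain ⟨f, hf, rfl⟩ := Finset.mem_image.1 hcF
        exact hFD f hf hc) (hb.mutuallyIndiscernible F) hD
  exact ⟨C, hCk, hC.mutuallyIndiscernible⟩

theorem TupleDpRankLE.add {M : Type*} [L.Structure M] {α₁ α₂ δ : Type*} {ρ : δ → M}
    {a₁ : α₁ → M} {a₂ : α₂ → M} {k₁ k₂ : ℕ} (h₁ : TupleDpRankLE L ρ a₁ k₁)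
    (h₂ : TupleDpRankLE L ρ a₂ k₂) : TupleDpRankLE L ρ (Sum.elim a₁ a₂) (k₁ + k₂) := by
  classical
  intro γ b hb
  obtain ⟨E, hEk, hE⟩ := h₂.exists_mutuallyIndiscernible hb
  set bad : Set ℝ := {c | c ∉ E ∧ ∃ ψ : L.Formula (γ ⊕ ((α₁ ⊕ α₂) ⊕ δ)), ¬ LocConstAt
    (fun q => ψ.Realize (Sum.elim (b q) (Sum.elim (Sum.elim a₁ a₂) ρ))) c}
  have hcard : ∀ D : Finset ℝ, (D : Set ℝ) ⊆ bad → D.card ≤ k₁ := by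
    intro D hD
    have hex : ∀ c ∈ D, ∃ ψ : L.Formula (γ ⊕ ((α₁ ⊕ α₂) ⊕ δ)), ¬ LocConstAt
        (fun q => ψ.Realize (Sum.elim (b q) (Sum.elim (Sum.elim a₁ a₂) ρ))) c :=
      fun c hc => (hD hc).2
    choose! ψ hψ using hex
    -- only finitely many coordinates of `a₂` matter
    set S : Finset α₂ := D.biUnion fun c => (ψ c).freeVarFinset.preimage
      (fun x => Sum.inr (Sum.inl (Sum.inr x)))
      (fun x _ y _ h => by simpa using h)
    set e := S.equivFin
    refine h₁.card_le (b := b) (θ := fun m => a₂ (e.symm m)) (E := E) (fun c hc => (hD hc).1) ?_ ?_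
    · intro ι _ u v huv hcut χ
      have key := hE ι u v huv hcut
        (χ.relabel (Sum.map id (Sum.map (fun m => (e.symm m : α₂)) id)))
      simp only [Formula.realize_relabel] at key
      convert key using 2 <;>
      · funext z
        rcases z with z | z | z <;> rfl
    · intro c hc
      have hf : ∀ y : (ψ c).freeVarFinset, ∃ z : γ ⊕ (Fin S.card ⊕ (α₁ ⊕ δ)), ∀ q,
          Sum.elim (b q) (Sum.elim (fun m => a₂ (e.symm m)) (Sum.elim a₁ ρ)) z =
            Sum.elim (b q) (Sum.elim (Sum.elim a₁ a₂) ρ) y := by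
        rintro ⟨x | (x | x) | x, hx⟩
        · exact ⟨Sum.inl x, fun _ => rfl⟩
        · exact ⟨Sum.inr (Sum.inr (Sum.inl x)), fun _ => rfl⟩
        · have hxS : x ∈ S := Finset.mem_biUnion.2 ⟨c, hc, Finset.mem_preimage.2 hx⟩
          exact ⟨Sum.inr (Sum.inl (e ⟨x, hxS⟩)), fun _ => by simp⟩
        · exact ⟨Sum.inr (Sum.inr (Sum.inr x)), fun _ => rfl⟩
      choose f hf using hf
      refine ⟨(ψ c).restrictFreeVar f, fun hloc => hψ c hc ?_⟩
      convert hloc using 3 with q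
      exact (BoundedFormula.realize_restrictFreeVar _ fun y => hf y q).symm
  have hfin : bad.Finite := by
    by_contra hinf
    obtain ⟨D, hD, hDk⟩ := Set.Infinite.exists_subset_card_eq hinf (k₁ + 1)
    have := hcard D hD
    omega
  refine ⟨hfin.toFinset ∪ E, (Finset.card_union_le _ _).trans
    (add_le_add (hcard _ (by simp)) hEk), ?_⟩
  have of_le : ∀ i j : ℚ, i ≤ j → SimRel (↑(hfin.toFinset ∪ E)) i j →
      ∀ ψ : L.Formula (γ ⊕ ((α₁ ⊕ α₂) ⊕ δ)),
        (ψ.Realize (Sum.elim (b i) (Sum.elim (Sum.elim a₁ a₂) ρ)) ↔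
          ψ.Realize (Sum.elim (b j) (Sum.elim (Sum.elim a₁ a₂) ρ))) := by
    intro i j hij hsim ψ
    rcases hij.eq_or_lt with rfl | hlt
    · rfl
    refine iff_of_forall_locConstAt
      (g := fun q => ψ.Realize (Sum.elim (b q) (Sum.elim (Sum.elim a₁ a₂) ρ))) hij
      fun c hc hc' => ?_
    by_contra hloc
    have hcmem : c ∈ hfin.toFinset ∪ E := by
      by_cases hcE : c ∈ E
      · exact Finset.mem_union_right _ hcE
      · exact Finset.mem_union_left _ (hfin.mem_toFinset.2 ⟨hcE, ψ, hloc⟩)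
    have hs := hsim c hcmem
    have : (i : ℝ) < j := by exact_mod_cast hlt
    linarith [hs.1.2 hc', hs.2.1 hc]
  intro i j hsim ψ
  rcases le_total i j with hij | hij
  · exact of_le i j hij hsim ψ
  · exact (of_le j i hij (fun c hc => ⟨(hsim c hc).1.symm, (hsim c hc).2.symm⟩) ψ).symm

/-- Theorem 3.4 (Kaplan–Onshuus–Usvyatsov): dp-rank is subadditive: if `tp(a_i / A)`
has dp-rank `≤ k_i` for `i = 1, 2`, then `tp(a_1, a_2 / A)` has dp-rank `≤ k_1 + k_2`. -/
theorem dpRank_subadditive (M : Type*) [L.Structure M] {α₁ α₂ δ : Type*}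
    (ρ : δ → M) (a₁ : α₁ → M) (a₂ : α₂ → M) (k₁ k₂ : ℕ)
    (h₁ : DpRankOverLE M ρ (completeTypeOver L a₁ ρ) k₁)
    (h₂ : DpRankOverLE M ρ (completeTypeOver L a₂ ρ) k₂) :
    DpRankOverLE M ρ (completeTypeOver L (Sum.elim a₁ a₂) ρ) (k₁ + k₂) := by
  intro a ha
  have ha₁ : TupleDpRankLE L ρ (a ∘ Sum.inl) k₁ := h₁ _ fun ψ hψ => by
    have key := ha (ψ.relabel (Sum.map Sum.inl id)) (by
      simp only [completeTypeOver, Set.mem_ofPred_eq, Formula.realize_relabel] at hψ ⊢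
      convert hψ using 1
      funext z
      rcases z with z | z <;> rfl)
    rw [Formula.realize_relabel] at key
    convert key using 1
    funext z
    rcases z with z | z <;> rfl
  have ha₂ : TupleDpRankLE L ρ (a ∘ Sum.inr) k₂ := h₂ _ fun ψ hψ => by
    have key := ha (ψ.relabel (Sum.map Sum.inr id)) (by
      simp only [completeTypeOver, Set.mem_ofPred_eq, Formula.realize_relabel] at hψ ⊢
      convert hψ using 1
      funext z
      rcases z with z | z <;> rfl)
    rw [Formula.realize_relabel] at key
    convert key using 1
    funext z
    rcases z with z | z <;> rfl
  have key := ha₁.add ha₂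
  rwa [Sum.elim_comp_inl_inr] at key

end VCPaper
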